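/- Let C be a 2-Calabi-Yau, Krull-Schmidt, Hom-finite, K-linear triangulated category (K a field) with a cluster tilting object T ∈ C, and let g : K_0(C,0) → K_0(C, add(T)) be the canonical projection onto the relative Grothendieck group. Then Ker(g) is generated by the set {[l_X] | X ∈ Ind(C) \ add(T[1])} if and only if Ind(C) is finite. -/

import Mathlib

open CategoryTheory CategoryTheory.Limits Opposite ZeroObject

attribute [local instance] CategoryTheory.Limits.hasBinaryBiproducts_of_finite_biproducts

universe w v u

noncomputable section

/-- An object of a preadditive category with finite biproducts is *indecomposable* if it is
nonzero and admits no nontrivial direct sum decomposition. -/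
def Indec {C : Type u} [Category.{v} C] [Preadditive C] [HasFiniteBiproducts C] (X : C) : Prop :=
  ¬ IsZero X ∧ ∀ (Y Z : C), Nonempty (X ≅ Y ⊞ Z) → IsZero Y ∨ IsZero Z

/-- A preadditive category is *Krull-Schmidt* if every object is (isomorphic to) a finite
biproduct of objects having local endomorphism rings. -/
def IsKrullSchmidt (C : Type u) [Category.{v} C] [Preadditive C] [HasFiniteBiproducts C] : Prop :=
  ∀ X : C, ∃ (n : ℕ) (f : Fin n → C),
    (∀ i, IsLocalRing (CategoryTheory.End (f i))) ∧ Nonempty (X ≅ ⨁ f)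

/-- `C` is *locally finite*: for every indecomposable `A` there are, up to isomorphism, only
finitely many indecomposables `B` with `Hom(A, B) ≠ 0`, and only finitely many indecomposables
`B` with `Hom(B, A) ≠ 0`. -/
def LocFinite (C : Type u) [Category.{v} C] [Preadditive C] [HasFiniteBiproducts C] : Prop :=
  ∀ A : C, Indec A →
    (∃ (n : ℕ) (ind : Fin n → C), ∀ B : C, Indec B → (∃ φ : A ⟶ B, φ ≠ 0) →
        ∃ i, Nonempty (B ≅ ind i)) ∧
    (∃ (n : ℕ) (ind : Fin n → C), ∀ B : C, Indec B → (∃ φ : B ⟶ A, φ ≠ 0) →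
        ∃ i, Nonempty (B ≅ ind i))

/-- `X` is a *dense* subcategory: `add X = C`, i.e. every object of `C` is a direct summand
of an object of `X`. -/
def DenseSub {C : Type u} [Category.{v} C] [Preadditive C] [HasFiniteBiproducts C]
    (X : Set C) : Prop :=
  ∀ A : C, ∃ X₀ ∈ X, ∃ B : C, Nonempty (X₀ ≅ A ⊞ B)

/-- `X` is a full additive subcategory closed under isomorphisms (given as a set of objects). -/
def AddSub (C : Type u) [Category.{v} C] [Preadditive C] [HasFiniteBiproducts C]
    (X : Set C) : Prop :=
  (0 : C) ∈ X ∧ (∀ {A B : C}, A ∈ X → B ∈ X → (A ⊞ B) ∈ X) ∧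
    (∀ {A B : C}, A ∈ X → Nonempty (A ≅ B) → B ∈ X)

section K0ZeroDefs

variable (C : Type u) [Category.{v} C] [Preadditive C] [HasFiniteBiproducts C]

/-- The relations `[A] + [B] - [A ⊞ B]` and `[A] - [B]` for `A ≅ B`, defining `K₀(C, 0)`. -/
def relAdd : Set (FreeAbelianGroup C) :=
  {x | (∃ A B : C,
          x = FreeAbelianGroup.of A + FreeAbelianGroup.of B - FreeAbelianGroup.of (A ⊞ B)) ∨
       (∃ A B : C, Nonempty (A ≅ B) ∧ x = FreeAbelianGroup.of A - FreeAbelianGroup.of B)}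

/-- `K₀(C, 0)`: the free abelian group on the isomorphism classes of objects of `C`. -/
abbrev K0Zero := FreeAbelianGroup C ⧸ AddSubgroup.closure (relAdd C)

/-- The class `[A]` of an object `A` in `K₀(C, 0)`. -/
def clsZero (A : C) : K0Zero C := QuotientAddGroup.mk (FreeAbelianGroup.of A)

end K0ZeroDefs

open CategoryTheory.Pretriangulated

section TriDefs

variable (C : Type u) [Category.{v} C] [Preadditive C] [HasZeroObject C] [HasShift C ℤ]
  [∀ n : ℤ, (shiftFunctor C n).Additive] [Pretriangulated C] [HasFiniteBiproducts C]

/-- `T` is a cluster tilting subcategory of the triangulated category `C`. -/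
structure IsClusterTilting (T : Set C) : Prop where
  sum_mem : ∀ {X Y : C}, X ∈ T → Y ∈ T → (X ⊞ Y) ∈ T
  summand_mem : ∀ {X Y Z : C}, Z ∈ T → Nonempty (Z ≅ X ⊞ Y) → X ∈ T
  contravariantly_finite : ∀ X : C, ∃ T₀ ∈ T, ∃ f : T₀ ⟶ X,
    ∀ T₁ ∈ T, ∀ g : T₁ ⟶ X, ∃ h : T₁ ⟶ T₀, h ≫ f = g
  covariantly_finite : ∀ X : C, ∃ T₀ ∈ T, ∃ f : X ⟶ T₀,
    ∀ T₁ ∈ T, ∀ g : X ⟶ T₁, ∃ h : T₀ ⟶ T₁, f ≫ h = g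
  char_left : ∀ X : C, X ∈ T ↔ ∀ T₀ ∈ T, ∀ φ : T₀ ⟶ X⟦(1 : ℤ)⟧, φ = 0
  char_right : ∀ X : C, X ∈ T ↔ ∀ T₀ ∈ T, ∀ φ : X ⟶ T₀⟦(1 : ℤ)⟧, φ = 0

/-- `X → Y → Z → X[1]` is an Auslander–Reiten triangle: a distinguished triangle with `X, Z`
indecomposable, first map left almost split and second map right almost split. -/
structure IsARTriangle {X Y Z : C} (f : X ⟶ Y) (g : Y ⟶ Z) (h : Z ⟶ X⟦(1 : ℤ)⟧) : Prop where
  distinguished : Triangle.mk f g h ∈ distTriang C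
  indec₁ : Indec X
  indec₃ : Indec Z
  not_section : ¬ ∃ r : Y ⟶ X, f ≫ r = 𝟙 X
  left_almost_split : ∀ {X' : C} (u : X ⟶ X'), (¬ ∃ r : X' ⟶ X, u ≫ r = 𝟙 X) →
    ∃ v : Y ⟶ X', f ≫ v = u
  not_retraction : ¬ ∃ s : Z ⟶ Y, s ≫ g = 𝟙 Z
  right_almost_split : ∀ {W : C} (u : W ⟶ Z), (¬ ∃ s : Z ⟶ W, s ≫ u = 𝟙 Z) →
    ∃ v : W ⟶ Y, v ≫ g = u

/-- The shifted subcategory `T[1]` (closed under isomorphisms). -/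
def shiftSet (T : Set C) : Set C := {W | ∃ t ∈ T, Nonempty (W ≅ t⟦(1 : ℤ)⟧)}

/-- `h` factors through an object of `T[1]`. -/
def FactorsThruShift (T : Set C) {Z X : C} (h : Z ⟶ X⟦(1 : ℤ)⟧) : Prop :=
  ∃ t ∈ T, ∃ (u : Z ⟶ t⟦(1 : ℤ)⟧) (v : t⟦(1 : ℤ)⟧ ⟶ X⟦(1 : ℤ)⟧), u ≫ v = h

/-- The set of elements `[X] + [Z] - [Y]` of `K₀(C, 0)` for all distinguished triangles. -/
def triRel : Set (K0Zero C) :=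
  {x | ∃ T : Triangle C, T ∈ (distTriang C) ∧
        x = clsZero C T.obj₁ + clsZero C T.obj₃ - clsZero C T.obj₂}

/-- The Grothendieck group `K₀(C)` of the triangulated category `C`. -/
abbrev K0Tri := K0Zero C ⧸ AddSubgroup.closure (triRel C)

/-- The canonical epimorphism `ψ : K₀(C, 0) → K₀(C)`. -/
def psiTri : K0Zero C →+ K0Tri C := QuotientAddGroup.mk' _

/-- The class `[A]` of an object `A` in `K₀(C)`. -/
def k0clsTri (A : C) : K0Tri C := psiTri C (clsZero C A)

/-- The relations `[X] + [Z] - [Y]` for triangles `X → Y → Z --h--> X[1]` with `h` factoring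
through an object of `T[1]`. -/
def relTriRel (T : Set C) : Set (K0Zero C) :=
  {x | ∃ Tr : Triangle C, Tr ∈ (distTriang C) ∧ FactorsThruShift C T Tr.mor₃ ∧
        x = clsZero C Tr.obj₁ + clsZero C Tr.obj₃ - clsZero C Tr.obj₂}

/-- The relative Grothendieck group `K₀(C, T)`. -/
abbrev K0RelTri (T : Set C) := K0Zero C ⧸ AddSubgroup.closure (relTriRel C T)

/-- The canonical projection `g : K₀(C, 0) → K₀(C, T)`. -/
def gProj (T : Set C) : K0Zero C →+ K0RelTri C T := QuotientAddGroup.mk' _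

/-- The set of elements `[δ] = [X] + [Z] - [Y]` of `K₀(C, 0)` arising from Auslander–Reiten
triangles `X → Y → Z → X[1]`; for the AR triangle starting at `X` this is `[l_X]`. -/
def arRelTri : Set (K0Zero C) :=
  {x | ∃ (X Y Z : C) (f : X ⟶ Y) (g : Y ⟶ Z) (h : Z ⟶ X⟦(1 : ℤ)⟧),
        IsARTriangle C f g h ∧ x = clsZero C X + clsZero C Z - clsZero C Y}

/-- The set of elements `[l_X]` for `X ∈ Ind(C) \ T[1]`. -/
def arRelTriOff (T : Set C) : Set (K0Zero C) :=
  {x | ∃ (X Y Z : C) (f : X ⟶ Y) (g : Y ⟶ Z) (h : Z ⟶ X⟦(1 : ℤ)⟧),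
        IsARTriangle C f g h ∧ X ∉ shiftSet C T ∧
        x = clsZero C X + clsZero C Z - clsZero C Y}

/-- `C` has Auslander–Reiten triangles: every indecomposable `X` admits an Auslander–Reiten
triangle `X → Y → τ⁻¹X → X[1]`. -/
def HasARTriangles : Prop :=
  ∀ X : C, Indec X →
    ∃ (Y Z : C) (f : X ⟶ Y) (g : Y ⟶ Z) (h : Z ⟶ X⟦(1 : ℤ)⟧), IsARTriangle C f g h

/-- `add T₀`: the objects isomorphic to direct summands of finite direct sums of copies
of `T₀`. -/
def addSet (T₀ : C) : Set C :=
  {X | ∃ (n : ℕ) (Y : C), Nonempty ((⨁ fun _ : Fin n => T₀) ≅ X ⊞ Y)}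

/-- `Ind(C)` is finite: there are finitely many indecomposables up to isomorphism. -/
def FinitelyManyIndec : Prop :=
  ∃ (n : ℕ) (ind : Fin n → C), ∀ X : C, Indec X → ∃ i, Nonempty (X ≅ ind i)

end TriDefs

/-- `C` is 2-Calabi–Yau over `K`: there is a bifunctorial isomorphism
`Hom(X, Y) ≅ D Hom(Y, X[2])`, `D` the `K`-linear duality. -/
def IsTwoCalabiYau (C : Type u) [Category.{v} C] [Preadditive C] [HasShift C ℤ]
    (K : Type w) [Field K] [Linear K C] : Prop :=
  ∃ e : ∀ X Y : C, (X ⟶ Y) ≃ₗ[K] Module.Dual K (Y ⟶ X⟦(2 : ℤ)⟧),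
    ∀ (X' X Y Y' : C) (u : X' ⟶ X) (v : Y ⟶ Y') (φ : X ⟶ Y) (ψ : Y' ⟶ X'⟦(2 : ℤ)⟧),
      (e X' Y' (u ≫ φ ≫ v)) ψ = (e X Y φ) (v ≫ ψ ≫ (shiftFunctor C (2 : ℤ)).map u)


section Helpers

section LinAlg

lemma finrank_right_exact {K : Type*} [Field K] {A B D : Type*} [AddCommGroup A] [AddCommGroup B]
    [AddCommGroup D] [Module K A] [Module K B] [Module K D] [FiniteDimensional K A]
    [FiniteDimensional K B] [FiniteDimensional K D] (f : A →ₗ[K] B) (g : B →ₗ[K] D)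
    (hex : ∀ b, g b = 0 → ∃ a, f a = b) (hz : ∀ a, g (f a) = 0) (hs : Function.Surjective g) :
    (Module.finrank K A : ℤ) - Module.finrank K B + Module.finrank K D =
      Module.finrank K (LinearMap.ker f) := by
  have h1 := f.finrank_range_add_finrank_ker
  have h2 := g.finrank_range_add_finrank_ker
  have h3 : LinearMap.range f = LinearMap.ker g := by
    ext b
    constructor
    · rintro ⟨a, rfl⟩
      exact hz a
    · intro hb
      exact hex b hb
  rw [LinearMap.range_eq_top.mpr hs, finrank_top, ← h3] at h2
  omega

lemma finrank_simple_eq {K : Type*} [Field K] {R : Type*} [Ring R] [IsLocalRing R]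
    [Algebra K R] {S : Type*} [AddCommGroup S] [Module R S] [Module K S] [IsScalarTower K R S]
    [IsSimpleModule R S]
    {S' : Type*} [AddCommGroup S'] [Module R S'] [Module K S'] [IsScalarTower K R S']
    [IsSimpleModule R S'] : Module.finrank K S' = Module.finrank K S := by
  obtain ⟨I, hI, ⟨e⟩⟩ := (isSimpleModule_iff_quot_maximal (R := R) (M := S)).mp inferInstance
  obtain ⟨J, hJ, ⟨e'⟩⟩ := (isSimpleModule_iff_quot_maximal (R := R) (M := S')).mp inferInstance
  have hIJ : I = J := by
    by_contra hne
    have := hI.out.codisjoint_of_ne hJ.out hne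
    rw [codisjoint_iff] at this
    have h1 : (1 : R) ∈ I ⊔ J := this ▸ Submodule.mem_top
    obtain ⟨a, ha, b, hb, hab⟩ := Submodule.mem_sup.mp h1
    rcases IsLocalRing.isUnit_or_isUnit_of_add_one hab with h | h
    · exact hI.ne_top (Ideal.eq_top_of_isUnit_mem _ ha h)
    · exact hJ.ne_top (Ideal.eq_top_of_isUnit_mem _ hb h)
  subst hIJ
  exact ((e'.trans e.symm).restrictScalars K).finrank_eq

lemma dvd_finrank_of_simple {K : Type*} [Field K] {R : Type*} [Ring R] [IsLocalRing R]
    [Algebra K R] {S : Type*} [AddCommGroup S] [Module R S] [Module K S] [IsScalarTower K R S]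
    [IsSimpleModule R S]
    {M : Type*} [AddCommGroup M] [Module R M] [hKM : Module K M] [hst : IsScalarTower K R M]
    [hfd : FiniteDimensional K M] :
    Module.finrank K S ∣ Module.finrank K M := by
  have hfl : IsFiniteLength R M := by
    rw [isFiniteLength_iff_isNoetherian_isArtinian]
    exact ⟨isNoetherian_of_tower K inferInstance, isArtinian_of_tower K inferInstance⟩
  revert hfd hst hKM
  induction hfl with
  | @of_subsingleton M _ _ _ =>
    intro _ _ _
    have h0 : Module.finrank K M = 0 := Module.finrank_zero_of_subsingleton
    rw [h0]
    exact dvd_zero _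
  | @of_simple_quotient M _ _ N _ hN ih =>
    intro _ _ _
    have h1 := (N.restrictScalars K).finrank_quotient_add_finrank
    have h2 : Module.finrank K (M ⧸ N.restrictScalars K) = Module.finrank K (M ⧸ N) :=
      (Submodule.Quotient.restrictScalarsEquiv K N).finrank_eq
    have h3 : Module.finrank K (M ⧸ N) = Module.finrank K S := finrank_simple_eq (R := R)
    have : FiniteDimensional K N :=
      inferInstanceAs (FiniteDimensional K (N.restrictScalars K))
    have h4 : Module.finrank K S ∣ Module.finrank K N := ih
    have h5 : Module.finrank K N = Module.finrank K (N.restrictScalars K) := rfl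
    rw [← h1, h2, h3, ← h5]
    exact (dvd_refl _).add h4

end LinAlg

section Tri

set_option linter.unusedSectionVars false

variable {C : Type u} [Category.{v} C] [Preadditive C] [HasZeroObject C] [HasShift C ℤ]
  [∀ n : ℤ, (shiftFunctor C n).Additive] [Pretriangulated C] [HasFiniteBiproducts C]

section Exact

variable {X Y Z : C} {f : X ⟶ Y} {g : Y ⟶ Z} {h : Z ⟶ X⟦(1 : ℤ)⟧}

lemma ex_yo2 (hd : Triangle.mk f g h ∈ distTriang C) {A : C} (p : Y ⟶ A) (hp : f ≫ p = 0) :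
    ∃ q : Z ⟶ A, p = g ≫ q :=
  Triangle.yoneda_exact₂ _ hd p hp

lemma ex_yo3 (hd : Triangle.mk f g h ∈ distTriang C) {A : C} (p : Z ⟶ A) (hp : g ≫ p = 0) :
    ∃ q : X⟦(1 : ℤ)⟧ ⟶ A, p = h ≫ q :=
  Triangle.yoneda_exact₃ _ hd p hp

lemma ex_co1 (hd : Triangle.mk f g h ∈ distTriang C) {A : C} (p : A ⟶ X⟦(1 : ℤ)⟧)
    (hp : p ≫ f⟦(1 : ℤ)⟧' = 0) : ∃ q : A ⟶ Z, p = q ≫ h :=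
  Triangle.coyoneda_exact₁ _ hd p hp

lemma ex_co2 (hd : Triangle.mk f g h ∈ distTriang C) {A : C} (p : A ⟶ Y)
    (hp : p ≫ g = 0) : ∃ q : A ⟶ X, p = q ≫ f :=
  Triangle.coyoneda_exact₂ _ hd p hp

lemma ex_co3 (hd : Triangle.mk f g h ∈ distTriang C) {A : C} (p : A ⟶ Z)
    (hp : p ≫ h = 0) : ∃ q : A ⟶ Y, p = q ≫ g :=
  Triangle.coyoneda_exact₃ _ hd p hp

lemma ex_yo4 (hd : Triangle.mk f g h ∈ distTriang C) {A : C} (p : X⟦(1 : ℤ)⟧ ⟶ A)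
    (hp : h ≫ p = 0) : ∃ q : Y⟦(1 : ℤ)⟧ ⟶ A, p = (-(f⟦(1 : ℤ)⟧')) ≫ q :=
  Triangle.yoneda_exact₃ _ (rot_of_distTriang _ hd) p hp

lemma ex_yo1 (hd : Triangle.mk f g h ∈ distTriang C) {A : C} (p : X ⟶ A)
    (hp : h ≫ p⟦(1 : ℤ)⟧' = 0) : ∃ q : Y ⟶ A, p = f ≫ q := by
  obtain ⟨q, hq⟩ := ex_yo4 hd _ hp
  obtain ⟨q, rfl⟩ := (shiftFunctor C (1 : ℤ)).map_surjective q
  refine ⟨-q, ?_⟩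
  apply (shiftFunctor C (1 : ℤ)).map_injective
  rw [hq]
  simp

end Exact

/-- Approximation triangle. -/
lemma exists_approx {T : Set C} (hT : IsClusterTilting C T) (W : C) :
    ∃ t₁ ∈ T, ∃ t₀ ∈ T, ∃ (i : t₁ ⟶ t₀) (p : t₀ ⟶ W) (j : W ⟶ t₁⟦(1 : ℤ)⟧),
      Triangle.mk i p j ∈ distTriang C := by
  obtain ⟨t₀, h₀, p, hp⟩ := hT.contravariantly_finite W
  obtain ⟨t₁, i, j, hd⟩ := distinguished_cocone_triangle₁ p
  refine ⟨t₁, ?_, t₀, h₀, i, p, j, hd⟩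
  rw [hT.char_left]
  intro s hs φ
  obtain ⟨ψ, hψ⟩ := ex_co1 hd φ ((hT.char_left t₀).1 h₀ s hs _)
  obtain ⟨χ, hχ⟩ := hp s hs ψ
  have h0 : p ≫ j = 0 := comp_distTriang_mor_zero₂₃ _ hd
  rw [hψ, ← hχ]
  change (χ ≫ p) ≫ j = 0
  rw [Category.assoc, h0, comp_zero]

/-- Morphisms killed by `T` factor through the approximation triangle. -/
lemma kill_factor {T : Set C} {W t₁ t₀ : C} (h₀ : t₀ ∈ T) {i : t₁ ⟶ t₀} {p : t₀ ⟶ W}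
    {j : W ⟶ t₁⟦(1 : ℤ)⟧} (hd : Triangle.mk i p j ∈ distTriang C) {B : C} (β : W ⟶ B)
    (hβ : ∀ t ∈ T, ∀ u : t ⟶ W, u ≫ β = 0) : ∃ k : t₁⟦(1 : ℤ)⟧ ⟶ B, β = j ≫ k :=
  ex_yo3 hd β (hβ t₀ h₀ p)

lemma factors_of_kill {T : Set C} (hT : IsClusterTilting C T) {Z X : C} (h : Z ⟶ X⟦(1 : ℤ)⟧)
    (hβ : ∀ t ∈ T, ∀ u : t ⟶ Z, u ≫ h = 0) : FactorsThruShift C T h := by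
  obtain ⟨t₁, h₁, t₀, h₀, i, p, j, hd⟩ := exists_approx hT Z
  obtain ⟨k, hk⟩ := kill_factor h₀ hd h hβ
  exact ⟨t₁, h₁, j, k, hk.symm⟩

lemma kill_of_factors {T : Set C} (hT : IsClusterTilting C T) {Z X : C} {h : Z ⟶ X⟦(1 : ℤ)⟧}
    (hf : FactorsThruShift C T h) : ∀ t ∈ T, ∀ u : t ⟶ Z, u ≫ h = 0 := by
  rintro t ht u
  obtain ⟨s, hs, a, b, rfl⟩ := hf
  rw [← Category.assoc, (hT.char_left s).1 hs t ht (u ≫ a), zero_comp]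

variable (K : Type w) [Field K] [Linear K C]

/-- Morphisms killed by precomposition with maps from objects of `T`. -/
def killE (T : Set C) (W B : C) : Submodule K (W ⟶ B) where
  carrier := {β | ∀ t ∈ T, ∀ u : t ⟶ W, u ≫ β = 0}
  add_mem' := by
    intro a b ha hb t ht u
    rw [Preadditive.comp_add, ha t ht u, hb t ht u, add_zero]
  zero_mem' := by
    intro t _ u
    exact comp_zero
  smul_mem' := by
    intro c a ha t ht u
    rw [Linear.comp_smul, ha t ht u, smul_zero]

/-- Dimension of `killE`. -/
def eps (T : Set C) (W B : C) : ℤ := Module.finrank K (killE K T W B)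

/-- Postcomposition on `killE`. -/
def killPost (T : Set C) (W : C) {A B : C} (f : A ⟶ B) : killE K T W A →ₗ[K] killE K T W B :=
  (Linear.rightComp K W f).restrict (by
    intro β hβ t ht u
    rw [Linear.rightComp_apply, ← Category.assoc, hβ t ht u, zero_comp])

/-- Precomposition on `killE`. -/
def killPre (T : Set C) (B : C) {V W : C} (f : V ⟶ W) : killE K T W B →ₗ[K] killE K T V B :=
  (Linear.leftComp K B f).restrict (by
    intro β hβ t ht u
    rw [Linear.leftComp_apply, ← Category.assoc]
    exact hβ t ht _)

lemma eps_cov (homFin : ∀ X Y : C, FiniteDimensional K (X ⟶ Y))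
    {T : Set C} (hT : IsClusterTilting C T) {X Y Z : C} {f : X ⟶ Y} {g : Y ⟶ Z}
    {h : Z ⟶ X⟦(1 : ℤ)⟧} (hd : Triangle.mk f g h ∈ distTriang C) (hf : FactorsThruShift C T h)
    (W : C) :
    eps K T W (X⟦(1 : ℤ)⟧) + eps K T W (Z⟦(1 : ℤ)⟧) - eps K T W (Y⟦(1 : ℤ)⟧) =
      Module.finrank K (LinearMap.range (Linear.rightComp K W h)) := by
  have hk := kill_of_factors hT hf
  obtain ⟨t₁, h₁, t₀, h₀, i, p, j, hd'⟩ := exists_approx hT W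
  have hij : j ≫ i⟦(1 : ℤ)⟧' = 0 := comp_distTriang_mor_zero₃₁ _ hd'
  have hfg : f ≫ g = 0 := comp_distTriang_mor_zero₁₂ _ hd
  have hhf : h ≫ f⟦(1 : ℤ)⟧' = 0 := comp_distTriang_mor_zero₃₁ _ hd
  have hj : ∀ t ∈ T, ∀ u : t ⟶ W, u ≫ j = 0 := fun t ht u => (hT.char_left t₁).1 h₁ t ht _
  have hlift : ∀ t ∈ T, ∀ u : t ⟶ Z, ∃ v : t ⟶ Y, u = v ≫ g := fun t ht u =>
    ex_co3 hd u (hk t ht u)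
  have := homFin W (X⟦(1 : ℤ)⟧)
  have := homFin W (Y⟦(1 : ℤ)⟧)
  have := homFin W (Z⟦(1 : ℤ)⟧)
  have key := finrank_right_exact (killPost K T W (f⟦(1 : ℤ)⟧')) (killPost K T W (g⟦(1 : ℤ)⟧'))
    ?_ ?_ ?_
  · have hker : (LinearMap.ker (killPost K T W (f⟦(1 : ℤ)⟧'))).map (killE K T W _).subtype =
        LinearMap.range (Linear.rightComp K W h) := by
      ext β
      constructor
      · rintro ⟨⟨β, hβ⟩, hβ', rfl⟩
        have hβ'' : β ≫ f⟦(1 : ℤ)⟧' = 0 := congrArg Subtype.val hβ'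
        obtain ⟨γ, hγ⟩ := ex_co1 hd β hβ''
        exact ⟨γ, hγ.symm⟩
      · rintro ⟨γ, rfl⟩
        refine ⟨⟨γ ≫ h, ?_⟩, ?_, rfl⟩
        · intro t ht u
          rw [← Category.assoc]
          exact hk t ht _
        · apply Subtype.ext
          change (γ ≫ h) ≫ f⟦(1 : ℤ)⟧' = 0
          rw [Category.assoc, hhf, comp_zero]
    rw [← hker, Submodule.finrank_map_subtype_eq]
    unfold eps
    rw [← key]
    ring
  · rintro ⟨β, hβ⟩ hβ'
    have hβ'' : β ≫ g⟦(1 : ℤ)⟧' = 0 := congrArg Subtype.val hβ'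
    obtain ⟨k, hk'⟩ := kill_factor h₀ hd' β hβ
    obtain ⟨b, rfl⟩ := (shiftFunctor C (1 : ℤ)).map_surjective k
    subst hk'
    rw [Category.assoc, ← Functor.map_comp] at hβ''
    obtain ⟨c, hc'⟩ := ex_yo1 hd' _ hβ''
    obtain ⟨c', hc''⟩ := hlift t₀ h₀ c
    have h0 : (b - i ≫ c') ≫ g = 0 := by
      rw [Preadditive.sub_comp, hc', hc'', Category.assoc, sub_self]
    obtain ⟨a, ha⟩ := ex_co2 hd _ h0
    refine ⟨⟨j ≫ a⟦(1 : ℤ)⟧', ?_⟩, ?_⟩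
    · intro t ht u
      rw [← Category.assoc, hj t ht u, zero_comp]
    · apply Subtype.ext
      change (j ≫ a⟦(1 : ℤ)⟧') ≫ f⟦(1 : ℤ)⟧' = j ≫ b⟦(1 : ℤ)⟧'
      have ha' : b = i ≫ c' + a ≫ f := by
        rw [← sub_eq_iff_eq_add']
        exact ha
      rw [ha', Functor.map_add, Functor.map_comp, Functor.map_comp, Preadditive.comp_add,
        ← Category.assoc j, hij, zero_comp, zero_add, Category.assoc]
  · rintro ⟨β, hβ⟩
    apply Subtype.ext
    change (β ≫ f⟦(1 : ℤ)⟧') ≫ g⟦(1 : ℤ)⟧' = 0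
    rw [Category.assoc, ← Functor.map_comp, hfg, Functor.map_zero, comp_zero]
  · rintro ⟨β, hβ⟩
    obtain ⟨k, rfl⟩ := kill_factor h₀ hd' β hβ
    obtain ⟨b, rfl⟩ := (shiftFunctor C (1 : ℤ)).map_surjective k
    obtain ⟨v, rfl⟩ := hlift t₁ h₁ b
    refine ⟨⟨j ≫ v⟦(1 : ℤ)⟧', ?_⟩, ?_⟩
    · intro t ht u
      rw [← Category.assoc, hj t ht u, zero_comp]
    · apply Subtype.ext
      change (j ≫ v⟦(1 : ℤ)⟧') ≫ g⟦(1 : ℤ)⟧' = j ≫ (v ≫ g)⟦(1 : ℤ)⟧'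
      rw [Functor.map_comp, Category.assoc]

lemma eps_contra (homFin : ∀ X Y : C, FiniteDimensional K (X ⟶ Y))
    {T : Set C} (hT : IsClusterTilting C T) {X Y Z : C} {f : X ⟶ Y} {g : Y ⟶ Z}
    {h : Z ⟶ X⟦(1 : ℤ)⟧} (hd : Triangle.mk f g h ∈ distTriang C) (hf : FactorsThruShift C T h)
    (B : C) :
    eps K T X B + eps K T Z B - eps K T Y B =
      Module.finrank K (LinearMap.range (Linear.leftComp K B h)) := by
  have hk := kill_of_factors hT hf
  have hfg : f ≫ g = 0 := comp_distTriang_mor_zero₁₂ _ hd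
  have hgh : g ≫ h = 0 := comp_distTriang_mor_zero₂₃ _ hd
  have hlift : ∀ t ∈ T, ∀ u : t ⟶ Z, ∃ v : t ⟶ Y, u = v ≫ g := fun t ht u =>
    ex_co3 hd u (hk t ht u)
  have := homFin X B
  have := homFin Y B
  have := homFin Z B
  have key := finrank_right_exact (killPre K T B g) (killPre K T B f) ?_ ?_ ?_
  · have hker : (LinearMap.ker (killPre K T B g)).map (killE K T _ B).subtype =
        LinearMap.range (Linear.leftComp K B h) := by
      ext β
      constructor
      · rintro ⟨⟨β, hβ⟩, hβ', rfl⟩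
        have hβ'' : g ≫ β = 0 := congrArg Subtype.val hβ'
        obtain ⟨γ, hγ⟩ := ex_yo3 hd β hβ''
        exact ⟨γ, hγ.symm⟩
      · rintro ⟨γ, rfl⟩
        refine ⟨⟨h ≫ γ, ?_⟩, ?_, rfl⟩
        · intro t ht u
          rw [← Category.assoc, hk t ht u, zero_comp]
        · apply Subtype.ext
          change g ≫ h ≫ γ = 0
          rw [← Category.assoc, hgh, zero_comp]
    rw [← hker, Submodule.finrank_map_subtype_eq]
    unfold eps
    rw [← key]
    ring
  · rintro ⟨β, hβ⟩ hβ'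
    have hβ'' : f ≫ β = 0 := congrArg Subtype.val hβ'
    obtain ⟨γ, hγ⟩ := ex_yo2 hd β hβ''
    refine ⟨⟨γ, ?_⟩, ?_⟩
    · intro t ht u
      obtain ⟨v, rfl⟩ := hlift t ht u
      rw [Category.assoc]
      have := hβ t ht v
      rw [hγ] at this
      exact this
    · apply Subtype.ext
      exact hγ.symm
  · rintro ⟨β, hβ⟩
    apply Subtype.ext
    change f ≫ g ≫ β = 0
    rw [← Category.assoc, hfg, zero_comp]
  · rintro ⟨β, hβ⟩
    obtain ⟨t₁, h₁, t₀, h₀, i, p, j, hd'⟩ := exists_approx hT X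
    obtain ⟨k, rfl⟩ := kill_factor h₀ hd' β hβ
    have hz : h ≫ j⟦(1 : ℤ)⟧' = 0 := by
      obtain ⟨s, hs, a, b, rfl⟩ := hf
      obtain ⟨b, rfl⟩ := (shiftFunctor C (1 : ℤ)).map_surjective b
      rw [Category.assoc, ← Functor.map_comp, (hT.char_left t₁).1 h₁ s hs (b ≫ j),
        Functor.map_zero, comp_zero]
    obtain ⟨q, hq'⟩ := ex_yo1 hd _ hz
    refine ⟨⟨q ≫ k, ?_⟩, ?_⟩
    · intro t ht u
      rw [← Category.assoc, (hT.char_left t₁).1 h₁ t ht (u ≫ q), zero_comp]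
    · apply Subtype.ext
      change f ≫ q ≫ k = j ≫ k
      rw [hq', Category.assoc]

end Tri

section Form

set_option linter.unusedSectionVars false

variable {C : Type u} [Category.{v} C] [Preadditive C] [HasZeroObject C] [HasShift C ℤ]
  [∀ n : ℤ, (shiftFunctor C n).Additive] [Pretriangulated C] [HasFiniteBiproducts C]
variable (K : Type w) [Field K] [Linear K C]

lemma cy_rank (homFin : ∀ X Y : C, FiniteDimensional K (X ⟶ Y)) (hCY : IsTwoCalabiYau C K)
    {Z U : C} (h : Z ⟶ U) (V : C) :
    Module.finrank K (LinearMap.range (Linear.rightComp K V h)) =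
      Module.finrank K (LinearMap.range (Linear.leftComp K (V⟦(2 : ℤ)⟧) h)) := by
  obtain ⟨e, he⟩ := hCY
  have := homFin V Z
  have := homFin V U
  have := homFin Z (V⟦(2 : ℤ)⟧)
  have := homFin U (V⟦(2 : ℤ)⟧)
  have hcomp : (e V U).toLinearMap ∘ₗ Linear.rightComp K V h =
      (Linear.leftComp K (V⟦(2 : ℤ)⟧) h).dualMap ∘ₗ (e V Z).toLinearMap := by
    ext φ ψ
    have := he V V Z U (𝟙 V) h φ ψ
    simpa using this
  rw [← LinearMap.finrank_range_dualMap_eq_finrank_range (Linear.leftComp K (V⟦(2 : ℤ)⟧) h),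
    ← LinearMap.range_comp_of_range_eq_top (Linear.leftComp K (V⟦(2 : ℤ)⟧) h).dualMap
      (LinearEquiv.range (e V Z)), ← hcomp, LinearMap.range_comp]
  exact (LinearEquiv.finrank_map_eq (e V U) _).symm

lemma eps_iso_right (T : Set C) (W : C) {A B : C} (e : A ≅ B) :
    eps K T W A = eps K T W B := by
  have := (LinearEquiv.ofLinearMap (killPost K T W e.hom) (killPost K T W e.inv)
    (LinearMap.ext fun β => Subtype.ext (by change (β.1 ≫ e.inv) ≫ e.hom = β.1; simp))
    (LinearMap.ext fun β => Subtype.ext (by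
      change (β.1 ≫ e.hom) ≫ e.inv = β.1; simp))).finrank_eq
  unfold eps
  rw [this]

lemma eps_iso_left (T : Set C) (B : C) {V W : C} (e : V ≅ W) :
    eps K T V B = eps K T W B := by
  have := (LinearEquiv.ofLinearMap (killPre K T B e.hom) (killPre K T B e.inv)
    (LinearMap.ext fun β => Subtype.ext (by change e.hom ≫ e.inv ≫ β.1 = β.1; simp))
    (LinearMap.ext fun β => Subtype.ext (by
      change e.inv ≫ e.hom ≫ β.1 = β.1; simp))).finrank_eq
  unfold eps
  rw [this]

/-- Universal property of `K0Zero`. -/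
def k0lift {M : Type*} [AddCommGroup M] (φ : C → M) (hadd : ∀ A B, φ (A ⊞ B) = φ A + φ B)
    (hiso : ∀ A B, Nonempty (A ≅ B) → φ A = φ B) : K0Zero C →+ M :=
  QuotientAddGroup.lift _ (FreeAbelianGroup.lift φ) (by
    rw [AddSubgroup.closure_le]
    rintro x (⟨A, B, rfl⟩ | ⟨A, B, hAB, rfl⟩)
    · change FreeAbelianGroup.lift φ _ = 0
      simp [hadd]
    · change FreeAbelianGroup.lift φ _ = 0
      simp [hiso A B hAB])

@[simp]
lemma k0lift_cls {M : Type*} [AddCommGroup M] (φ : C → M) (hadd : ∀ A B, φ (A ⊞ B) = φ A + φ B)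
    (hiso : ∀ A B, Nonempty (A ≅ B) → φ A = φ B) (A : C) :
    k0lift φ hadd hiso (clsZero C A) = φ A := by
  change FreeAbelianGroup.lift φ (FreeAbelianGroup.of A) = φ A
  simp

lemma k0_hom_ext {M : Type*} [AddCommGroup M] {a b : K0Zero C →+ M}
    (h : ∀ A, a (clsZero C A) = b (clsZero C A)) : a = b := by
  apply QuotientAddGroup.addMonoidHom_ext
  apply FreeAbelianGroup.lift_ext
  exact h

lemma cls_add (A B : C) : clsZero C (A ⊞ B) = clsZero C A + clsZero C B := by
  unfold clsZero
  rw [← QuotientAddGroup.mk_add, eq_comm, ← sub_eq_zero, ← QuotientAddGroup.mk_sub,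
    QuotientAddGroup.eq_zero_iff]
  exact AddSubgroup.subset_closure (Or.inl ⟨A, B, rfl⟩)

lemma cls_iso {A B : C} (e : A ≅ B) : clsZero C A = clsZero C B := by
  unfold clsZero
  rw [← sub_eq_zero, ← QuotientAddGroup.mk_sub, QuotientAddGroup.eq_zero_iff]
  exact AddSubgroup.subset_closure (Or.inr ⟨A, B, ⟨e⟩, rfl⟩)

lemma biprod_dist (A B : C) :
    Triangle.mk (biprod.inl : A ⟶ A ⊞ B) biprod.snd (0 : B ⟶ A⟦(1 : ℤ)⟧) ∈ distTriang C :=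
  binaryBiproductTriangle_distinguished A B

lemma factors_zero (_homFin : ∀ X Y : C, FiniteDimensional K (X ⟶ Y)) {T : Set C}
    (hT : IsClusterTilting C T) (Z X : C) : FactorsThruShift C T (0 : Z ⟶ X⟦(1 : ℤ)⟧) :=
  factors_of_kill hT _ (fun _ _ _ => comp_zero)

lemma eps_add_right (homFin : ∀ X Y : C, FiniteDimensional K (X ⟶ Y)) {T : Set C}
    (hT : IsClusterTilting C T) (W A B : C) :
    eps K T W ((A ⊞ B)⟦(1 : ℤ)⟧) = eps K T W (A⟦(1 : ℤ)⟧) + eps K T W (B⟦(1 : ℤ)⟧) := by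
  have h := eps_cov K homFin hT (biprod_dist A B) (factors_zero K homFin hT B A) W
  have h0 : Linear.rightComp K W (0 : B ⟶ A⟦(1 : ℤ)⟧) = 0 := by
    ext
    simp
  rw [h0, LinearMap.range_zero, finrank_bot] at h
  simp only [Nat.cast_zero] at h
  linarith

lemma eps_add_left (homFin : ∀ X Y : C, FiniteDimensional K (X ⟶ Y)) {T : Set C}
    (hT : IsClusterTilting C T) (V W B : C) :
    eps K T (V ⊞ W) B = eps K T V B + eps K T W B := by
  have h := eps_contra K homFin hT (biprod_dist V W) (factors_zero K homFin hT W V) B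
  have h0 : Linear.leftComp K B (0 : W ⟶ V⟦(1 : ℤ)⟧) = 0 := by
    ext
    simp
  rw [h0, LinearMap.range_zero, finrank_bot] at h
  simp only [Nat.cast_zero] at h
  linarith

/-- The bilinear form `([W],[A]) ↦ eps W A[1]`. -/
def bform (homFin : ∀ X Y : C, FiniteDimensional K (X ⟶ Y)) {T : Set C}
    (hT : IsClusterTilting C T) : K0Zero C →+ K0Zero C →+ ℤ :=
  k0lift (fun W => k0lift (fun A => eps K T W (A⟦(1 : ℤ)⟧))
      (fun A B => eps_add_right K homFin hT W A B)
      (fun A B ⟨e⟩ => eps_iso_right K T W ((shiftFunctor C (1 : ℤ)).mapIso e)))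
    (fun V W => k0_hom_ext (fun A => by
      simp only [k0lift_cls, AddMonoidHom.add_apply]
      exact eps_add_left K homFin hT V W _))
    (fun V W ⟨e⟩ => k0_hom_ext (fun A => by
      simp only [k0lift_cls]
      exact eps_iso_left K T _ e))

lemma bform_cls (homFin : ∀ X Y : C, FiniteDimensional K (X ⟶ Y)) {T : Set C}
    (hT : IsClusterTilting C T) (W A : C) :
    bform K homFin hT (clsZero C W) (clsZero C A) = eps K T W (A⟦(1 : ℤ)⟧) := by
  unfold bform
  rw [k0lift_cls, k0lift_cls]

lemma ker_gProj (T : Set C) : (gProj C T).ker = AddSubgroup.closure (relTriRel C T) :=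
  QuotientAddGroup.ker_mk' _

lemma bform_symm (homFin : ∀ X Y : C, FiniteDimensional K (X ⟶ Y)) (hCY : IsTwoCalabiYau C K)
    {T : Set C} (hT : IsClusterTilting C T) {y : K0Zero C} (hy : y ∈ (gProj C T).ker) (V : C) :
    bform K homFin hT (clsZero C V) y = bform K homFin hT y (clsZero C (V⟦(1 : ℤ)⟧)) := by
  rw [ker_gProj] at hy
  induction hy using AddSubgroup.closure_induction with
  | mem x hx =>
    obtain ⟨⟨X, Y, Z, f, g, h⟩, hd, hf, rfl⟩ := hx
    have h1 := eps_cov K homFin hT hd hf V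
    have h2 := eps_contra K homFin hT hd hf (V⟦(2 : ℤ)⟧)
    have h3 := cy_rank K homFin hCY h V
    rw [h3] at h1
    have h4 : ∀ W, eps K T W ((V⟦(1 : ℤ)⟧)⟦(1 : ℤ)⟧) = eps K T W (V⟦(2 : ℤ)⟧) := fun W =>
      eps_iso_right K T W ((shiftFunctorAdd' C (1 : ℤ) 1 2 (by norm_num)).app V).symm
    simp only [map_add, map_sub, AddMonoidHom.add_apply, AddMonoidHom.sub_apply, bform_cls, h4]
    exact h1.trans h2.symm
  | zero => simp
  | add x y _ _ hx hy => simp only [map_add, AddMonoidHom.add_apply, hx, hy]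
  | neg x _ hx => simp only [map_neg, AddMonoidHom.neg_apply, hx]

end Form

section KS

set_option linter.unusedSectionVars false

variable {C : Type u} [Category.{v} C] [Preadditive C] [HasZeroObject C] [HasShift C ℤ]
  [∀ n : ℤ, (shiftFunctor C n).Additive] [Pretriangulated C] [HasFiniteBiproducts C]

lemma split_summand {A X : C} (s : A ⟶ X) (r : X ⟶ A) (hsr : s ≫ r = 𝟙 A) :
    ∃ (B : C), Nonempty (X ≅ A ⊞ B) ∧ (IsZero B → IsIso s) := by
  obtain ⟨B, g, h, hd⟩ := distinguished_cocone_triangle s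
  have hm : Mono s := (SplitMono.mk r hsr).mono
  have h0 : (Triangle.mk s g h).mor₃ = 0 := Triangle.mor₃_eq_zero_of_mono₁ _ hd hm
  obtain ⟨e, -⟩ := exists_iso_binaryBiproduct_of_distTriang _ hd h0
  exact ⟨B, ⟨e⟩, fun hB => (Triangle.isZero₃_iff_isIso₁ _ hd).1 hB⟩

lemma split_iso {A X : C} (hX : Indec X) (hA : ¬ IsZero A) (s : A ⟶ X) (r : X ⟶ A)
    (hsr : s ≫ r = 𝟙 A) : IsIso s := by
  obtain ⟨B, hB, hi⟩ := split_summand s r hsr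
  exact hi ((hX.2 _ _ hB).resolve_left hA)

lemma split_iso' {A X : C} (hX : Indec X) (hA : ¬ IsZero A) (s : A ⟶ X) (r : X ⟶ A)
    (hsr : s ≫ r = 𝟙 A) : r ≫ s = 𝟙 X := by
  have := split_iso hX hA s r hsr
  rw [← cancel_epi s, ← Category.assoc, hsr, Category.id_comp, Category.comp_id]

lemma local_of_iso {A X : C} (e : A ≅ X) (h : IsLocalRing (End A)) : IsLocalRing (End X) := by
  have : Nontrivial (End X) := e.conj.symm.toEquiv.nontrivial
  refine IsLocalRing.of_isUnit_or_isUnit_of_isUnit_add (fun a b hab => ?_)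
  have h1 : e.symm.conj (a + b) = e.symm.conj a + e.symm.conj b := by
    change e.hom ≫ ((a : X ⟶ X) + (b : X ⟶ X)) ≫ e.inv = e.hom ≫ a ≫ e.inv + e.hom ≫ b ≫ e.inv
    rw [Preadditive.add_comp, Preadditive.comp_add]
  have h2 : IsUnit (e.symm.conj (a + b)) := hab.map _
  rw [h1] at h2
  rcases IsLocalRing.isUnit_or_isUnit_of_isUnit_add h2 with h | h
  · left
    exact (MulEquiv.isUnit_map e.symm.conj).1 h
  · right
    exact (MulEquiv.isUnit_map e.symm.conj).1 h

lemma not_zero_of_local {A : C} (h : IsLocalRing (End A)) : ¬ IsZero A := by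
  intro hA
  exact one_ne_zero (α := End A) (hA.eq_of_src _ _)

lemma indec_local (hKS : IsKrullSchmidt C) {X : C} (hX : Indec X) : IsLocalRing (End X) := by
  obtain ⟨n, f, hf, ⟨e⟩⟩ := hKS X
  by_cases hn : n = 0
  · subst hn
    exfalso
    apply hX.1
    refine IsZero.of_iso ?_ e
    rw [IsZero.iff_id_eq_zero]
    ext i
    exact i.elim0
  · let i : Fin n := ⟨0, Nat.pos_of_ne_zero hn⟩
    have := split_iso hX (not_zero_of_local (hf i)) (biproduct.ι f i ≫ e.inv)
      (e.hom ≫ biproduct.π f i) (by simp)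
    exact local_of_iso (asIso (biproduct.ι f i ≫ e.inv)) (hf i)

lemma local_indec {X : C} (hX : IsLocalRing (End X)) : Indec X := by
  refine ⟨not_zero_of_local hX, ?_⟩
  rintro Y Z ⟨e⟩
  let p : End X := e.hom ≫ biprod.fst ≫ biprod.inl ≫ e.inv
  let q : End X := e.hom ≫ biprod.snd ≫ biprod.inr ≫ e.inv
  have hpq : p + q = 1 := by
    change p + q = 𝟙 X
    have : e.hom ≫ (biprod.fst ≫ biprod.inl + biprod.snd ≫ biprod.inr) ≫ e.inv = 𝟙 X := by
      rw [biprod.total]; simp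
    rw [Preadditive.add_comp, Preadditive.comp_add] at this
    simp only [Category.assoc] at this
    exact this
  have hqp : p * q = 0 := by
    change q ≫ p = 0
    simp [p, q]
  have hpq' : q * p = 0 := by
    change p ≫ q = 0
    simp [p, q]
  rcases IsLocalRing.isUnit_or_isUnit_of_add_one hpq with h | h
  · right
    have hq : q = 0 := by
      have := h.mul_left_cancel (hqp.trans (mul_zero p).symm)
      exact this
    rw [IsZero.iff_id_eq_zero]
    have : biprod.inr ≫ e.inv ≫ q ≫ e.hom ≫ biprod.snd = 𝟙 Z := by simp [q]
    rw [← this, hq]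
    simp
  · left
    have hq : p = 0 := by
      have := h.mul_left_cancel (hpq'.trans (mul_zero q).symm)
      exact this
    rw [IsZero.iff_id_eq_zero]
    have : biprod.inl ≫ e.inv ≫ p ≫ e.hom ≫ biprod.fst = 𝟙 Y := by simp [p]
    rw [← this, hq]
    simp

/-- Splitting off the first summand. -/
def biproductSucc {n : ℕ} (f : Fin (n + 1) → C) :
    (⨁ f) ≅ f 0 ⊞ (⨁ fun i : Fin n => f i.succ) where
  hom := biprod.lift (biproduct.π f 0) (biproduct.lift fun i => biproduct.π f i.succ)
  inv := biprod.desc (biproduct.ι f 0) (biproduct.desc fun i => biproduct.ι f i.succ)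
  hom_inv_id := by
    rw [biprod.lift_desc, biproduct.lift_desc, ← biproduct.total, Fin.sum_univ_succ]
  inv_hom_id := by
    ext
    · simp
    · rename_i j
      simp [biproduct.ι_π_ne _ (Fin.succ_ne_zero j).symm]
    · rename_i i
      simp [biproduct.ι_π_ne _ (Fin.succ_ne_zero i)]
    · rename_i i j
      by_cases hij : i = j
      · subst hij
        simp
      · simp [biproduct.ι_π_ne _ hij,
          biproduct.ι_π_ne _ (fun h => hij (Fin.succ_injective _ h))]

lemma cls_zero_of_isZero {A : C} (hA : IsZero A) : clsZero C A = 0 := by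
  have e : A ≅ A ⊞ A := hA.iso (by
    rw [IsZero.iff_id_eq_zero]
    ext
    · exact hA.eq_of_src _ _
    · exact hA.eq_of_tgt _ _
    · exact hA.eq_of_tgt _ _
    · exact hA.eq_of_src _ _)
  have h1 := cls_iso e
  rw [cls_add] at h1
  simpa using h1

lemma isZero_biproduct_zero (f : Fin 0 → C) : IsZero (⨁ f) := by
  rw [IsZero.iff_id_eq_zero]
  ext i
  exact i.elim0

lemma cls_biproduct {n : ℕ} (f : Fin n → C) : clsZero C (⨁ f) = ∑ i, clsZero C (f i) := by
  induction n with
  | zero => simp [cls_zero_of_isZero (isZero_biproduct_zero f)]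
  | succ n ih => rw [cls_iso (biproductSucc f), cls_add, ih, Fin.sum_univ_succ]

lemma cls_mem (hKS : IsKrullSchmidt C) {H : AddSubgroup (K0Zero C)}
    (hH : ∀ W : C, Indec W → clsZero C W ∈ H) (x : K0Zero C) : x ∈ H := by
  obtain ⟨x, rfl⟩ := QuotientAddGroup.mk_surjective x
  have hA : ∀ A : C, clsZero C A ∈ H := by
    intro A
    obtain ⟨n, f, hf, ⟨e⟩⟩ := hKS A
    rw [cls_iso e, cls_biproduct]
    exact AddSubgroup.sum_mem _ (fun i _ => hH _ (local_indec (hf i)))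
  induction x using FreeAbelianGroup.induction_on with
  | zero => exact H.zero_mem
  | of A => exact hA A
  | neg A _ => exact H.neg_mem (hA A)
  | add x y hx hy => exact H.add_mem hx hy

lemma k0_hom_ext_indec (hKS : IsKrullSchmidt C) {M : Type*} [AddCommGroup M]
    {a b : K0Zero C →+ M} (h : ∀ W, Indec W → a (clsZero C W) = b (clsZero C W)) : a = b := by
  refine DFunLike.ext _ _ (fun x => ?_)
  exact cls_mem hKS (H := a.eqLocus b) h x

lemma T_iso {T : Set C} (hT : IsClusterTilting C T) {A B : C} (e : A ≅ B) (hA : A ∈ T) :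
    B ∈ T := by
  refine hT.summand_mem (Y := 0) hA ⟨e.trans ?_⟩
  exact (isoBiprodZero (isZero_zero C))

lemma T_retract {T : Set C} (hT : IsClusterTilting C T) {A B : C} (s : A ⟶ B) (r : B ⟶ A)
    (hsr : s ≫ r = 𝟙 A) (hB : B ∈ T) : A ∈ T := by
  obtain ⟨D, hD, -⟩ := split_summand s r hsr
  exact hT.summand_mem hB hD

lemma indec_iso {A B : C} (e : A ≅ B) (hA : Indec A) : Indec B :=
  ⟨fun h => hA.1 (h.of_iso e), fun Y Z ⟨e'⟩ => hA.2 Y Z ⟨e.trans e'⟩⟩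

lemma isUnit_of_split {X : C} (hX : Indec X) (a : End X) (s : X ⟶ X) (h : s ≫ a = 𝟙 X) :
    IsUnit a := by
  have h2 := split_iso' hX hX.1 s a h
  exact ⟨⟨a, s, h, h2⟩, rfl⟩

lemma indec_shift {X : C} (hKS : IsKrullSchmidt C) (hX : Indec X) (n : ℤ) : Indec (X⟦n⟧) := by
  apply local_indec
  have := indec_local hKS hX
  have hff : (shiftFunctor C n).FullyFaithful := Functor.FullyFaithful.ofFullyFaithful _
  have : Nontrivial (End (X⟦n⟧)) := hff.mulEquivEnd X |>.symm.toEquiv.nontrivial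
  refine IsLocalRing.of_isUnit_or_isUnit_of_isUnit_add (fun a b hab => ?_)
  let φ := hff.mulEquivEnd X
  obtain ⟨a, rfl⟩ := φ.surjective a
  obtain ⟨b, rfl⟩ := φ.surjective b
  have h1 : φ (a + b) = φ a + φ b := (shiftFunctor C n).map_add
  rw [← h1, MulEquiv.isUnit_map] at hab
  rw [MulEquiv.isUnit_map, MulEquiv.isUnit_map]
  exact IsLocalRing.isUnit_or_isUnit_of_isUnit_add hab

end KS

section AR

set_option linter.unusedSectionVars false

variable {C : Type u} [Category.{v} C] [Preadditive C] [HasZeroObject C] [HasShift C ℤ]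
  [∀ n : ℤ, (shiftFunctor C n).Additive] [Pretriangulated C] [HasFiniteBiproducts C]
variable (K : Type w) [Field K] [Linear K C]

/-- Non-units in a local endomorphism ring form a subspace. -/
def nonunitSub {A : C} (hA : IsLocalRing (End A)) : Submodule K (A ⟶ A) where
  carrier := {a | ¬ IsUnit (show End A from a)}
  add_mem' := by
    intro a b ha hb
    exact IsLocalRing.nonunits_add (R := End A) ha hb
  zero_mem' := by
    exact not_isUnit_zero (M₀ := End A)
  smul_mem' := by
    intro c a ha h
    apply ha
    obtain ⟨⟨_, b, h1, h2⟩, rfl⟩ := h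
    refine ⟨⟨a, c • (show A ⟶ A from b), ?_, ?_⟩, rfl⟩
    · change (c • (show A ⟶ A from b)) ≫ a = 𝟙 A
      change (show A ⟶ A from b) ≫ (c • a) = 𝟙 A at h1
      rw [Linear.smul_comp, ← Linear.comp_smul]
      exact h1
    · change a ≫ (c • (show A ⟶ A from b)) = 𝟙 A
      change (c • a) ≫ (show A ⟶ A from b) = 𝟙 A at h2
      rw [Linear.comp_smul, ← Linear.smul_comp]
      exact h2

lemma exists_socle (hKS : IsKrullSchmidt C) (hCY : IsTwoCalabiYau C K) {Z : C} (hZ : Indec Z) :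
    ∃ h : Z ⟶ Z⟦(2 : ℤ)⟧, h ≠ 0 ∧
      (∀ (W : C) (u : W ⟶ Z), (¬ ∃ s : Z ⟶ W, s ≫ u = 𝟙 Z) → u ≫ h = 0) ∧
      (∀ (V : C) (v : Z⟦(2 : ℤ)⟧ ⟶ V), (¬ ∃ r, v ≫ r = 𝟙 (Z⟦(2 : ℤ)⟧)) → h ≫ v = 0) := by
  obtain ⟨e, he⟩ := hCY
  have hloc := indec_local hKS (indec_shift hKS hZ 2)
  have h1 : 𝟙 (Z⟦(2 : ℤ)⟧) ∉ nonunitSub K hloc := fun h => h (isUnit_one (M := End _))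
  obtain ⟨l, hl1, hl⟩ := Submodule.exists_le_ker_of_notMem h1
  refine ⟨(e Z (Z⟦(2 : ℤ)⟧)).symm l, ?_, ?_, ?_⟩
  · intro h0
    apply hl1
    rw [LinearEquiv.symm_apply_eq, map_zero] at h0
    rw [h0]
    rfl
  · intro W u hu
    apply (e _ _).injective
    rw [map_zero]
    ext ψ
    have h2 := he W Z _ _ u (𝟙 _) ((e Z (Z⟦(2 : ℤ)⟧)).symm l) ψ
    rw [Category.comp_id, Category.id_comp, LinearEquiv.apply_symm_apply] at h2
    rw [h2]
    change l _ = 0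
    apply hl
    rintro ⟨⟨_, b, h3, h4⟩, rfl⟩
    change (show Z⟦(2 : ℤ)⟧ ⟶ Z⟦(2 : ℤ)⟧ from b) ≫ ψ ≫ _ = 𝟙 _ at h3
    apply hu
    rw [← Category.assoc] at h3
    obtain ⟨s, hs⟩ := (shiftFunctor C (2 : ℤ)).map_surjective
      ((show Z⟦(2 : ℤ)⟧ ⟶ Z⟦(2 : ℤ)⟧ from b) ≫ ψ)
    refine ⟨s, (shiftFunctor C (2 : ℤ)).map_injective ?_⟩
    rw [Functor.map_comp, hs, h3, CategoryTheory.Functor.map_id]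
  · intro V v hv
    apply (e _ _).injective
    rw [map_zero]
    ext ψ
    have h2 := he Z Z _ _ (𝟙 Z) v ((e Z (Z⟦(2 : ℤ)⟧)).symm l) ψ
    rw [Category.id_comp, CategoryTheory.Functor.map_id, Category.comp_id, LinearEquiv.apply_symm_apply] at h2
    rw [h2]
    change l _ = 0
    apply hl
    rintro ⟨⟨_, b, h3, h4⟩, rfl⟩
    change (v ≫ ψ) ≫ (show Z⟦(2 : ℤ)⟧ ⟶ Z⟦(2 : ℤ)⟧ from b) = 𝟙 _ at h4
    apply hv
    rw [Category.assoc] at h4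
    exact ⟨_, h4⟩

/-- `Z[2] ≅ Z[1][1]`. -/
def sh2 (Z : C) : Z⟦(2 : ℤ)⟧ ≅ Z⟦(1 : ℤ)⟧⟦(1 : ℤ)⟧ :=
  (shiftFunctorAdd' C (1 : ℤ) 1 2 (by norm_num)).app Z

lemma ar_exists (hKS : IsKrullSchmidt C) (hCY : IsTwoCalabiYau C K) {Z : C} (hZ : Indec Z) :
    ∃ (Y : C) (f : Z⟦(1 : ℤ)⟧ ⟶ Y) (g : Y ⟶ Z) (h : Z ⟶ Z⟦(1 : ℤ)⟧⟦(1 : ℤ)⟧),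
      IsARTriangle C f g h := by
  obtain ⟨h, hne, hl, hr⟩ := exists_socle K hKS hCY hZ
  have hne' : h ≫ (sh2 Z).hom ≠ 0 := by
    intro h0
    apply hne
    rw [← cancel_mono (sh2 Z).hom, h0, zero_comp]
  obtain ⟨Y, f, g, hd⟩ := distinguished_cocone_triangle₂ (h ≫ (sh2 Z).hom)
  have hgh : g ≫ h ≫ (sh2 Z).hom = 0 := comp_distTriang_mor_zero₂₃ _ hd
  have hhf : (h ≫ (sh2 Z).hom) ≫ f⟦(1 : ℤ)⟧' = 0 := comp_distTriang_mor_zero₃₁ _ hd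
  refine ⟨Y, f, g, h ≫ (sh2 Z).hom, hd, indec_shift hKS hZ 1, hZ, ?_, ?_, ?_, ?_⟩
  · rintro ⟨r, hr'⟩
    apply hne'
    have : (h ≫ (sh2 Z).hom) ≫ (f ≫ r)⟦(1 : ℤ)⟧' = 0 := by
      rw [Functor.map_comp, ← Category.assoc, hhf, zero_comp]
    rw [hr', CategoryTheory.Functor.map_id, Category.comp_id] at this
    exact this
  · intro X' u hu
    have h1 : h ≫ (sh2 Z).hom ≫ u⟦(1 : ℤ)⟧' = 0 := by
      apply hr
      rintro ⟨r, hr'⟩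
      apply hu
      obtain ⟨s, hs⟩ := (shiftFunctor C (1 : ℤ)).map_surjective (r ≫ (sh2 Z).hom)
      refine ⟨s, (shiftFunctor C (1 : ℤ)).map_injective ?_⟩
      rw [Functor.map_comp, hs, ← cancel_epi (sh2 Z).hom, CategoryTheory.Functor.map_id, Category.comp_id]
      rw [Category.assoc] at hr'
      have := congrArg (· ≫ (sh2 Z).hom) hr'
      simpa using this
    rw [← Category.assoc] at h1
    obtain ⟨v, hv⟩ := ex_yo1 hd u h1
    exact ⟨v, hv.symm⟩
  · rintro ⟨s, hs⟩
    apply hne'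
    rw [← Category.id_comp (h ≫ (sh2 Z).hom), ← hs, Category.assoc, hgh, comp_zero]
  · intro W u hu
    have h1 : u ≫ h ≫ (sh2 Z).hom = 0 := by
      rw [← Category.assoc, hl W u hu, zero_comp]
    obtain ⟨v, hv⟩ := ex_co3 hd u h1
    exact ⟨v, hv.symm⟩

section

variable {X Y Z : C} {f : X ⟶ Y} {g : Y ⟶ Z} {h : Z ⟶ X⟦(1 : ℤ)⟧}

lemma ar_ne (har : IsARTriangle C f g h) : h ≠ 0 := by
  intro h0
  obtain ⟨s, hs⟩ := ex_co3 har.distinguished (𝟙 Z) (by rw [h0, comp_zero])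
  exact har.not_retraction ⟨s, hs.symm⟩

lemma ar_kill (har : IsARTriangle C f g h) {W : C} (u : W ⟶ Z)
    (hu : ¬ ∃ s : Z ⟶ W, s ≫ u = 𝟙 Z) : u ≫ h = 0 := by
  obtain ⟨v, rfl⟩ := har.right_almost_split u hu
  have : g ≫ h = 0 := comp_distTriang_mor_zero₂₃ _ har.distinguished
  rw [Category.assoc, this, comp_zero]

lemma ar_shift (hKS : IsKrullSchmidt C) (hCY : IsTwoCalabiYau C K)
    (har : IsARTriangle C f g h) : Nonempty (X ≅ Z⟦(1 : ℤ)⟧) := by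
  obtain ⟨e, he⟩ := hCY
  have h0 : e Z (X⟦(1 : ℤ)⟧) h ≠ 0 := by
    intro h0
    exact ar_ne har ((LinearEquiv.map_eq_zero_iff _).1 h0)
  obtain ⟨ψ, hψ⟩ : ∃ ψ, e Z (X⟦(1 : ℤ)⟧) h ψ ≠ 0 := by
    by_contra hc
    push Not at hc
    exact h0 (LinearMap.ext hc)
  obtain ⟨ψ', hψ'⟩ := (shiftFunctor C (1 : ℤ)).map_surjective (ψ ≫ (sh2 Z).hom)
  have hsec : ∃ r, ψ' ≫ r = 𝟙 X := by
    by_contra hc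
    obtain ⟨v, rfl⟩ := har.left_almost_split ψ' hc
    have hhf : h ≫ f⟦(1 : ℤ)⟧' = 0 := comp_distTriang_mor_zero₃₁ _ har.distinguished
    have h1 : h ≫ ψ = 0 := by
      rw [← cancel_mono (sh2 Z).hom, Category.assoc, ← hψ', Functor.map_comp, ← Category.assoc,
        hhf, zero_comp, zero_comp]
    have h2 := he Z Z _ _ (𝟙 Z) ψ h (𝟙 _)
    rw [Category.id_comp, h1, map_zero, CategoryTheory.Functor.map_id, Category.comp_id, Category.comp_id] at h2
    exact hψ h2.symm
  obtain ⟨r, hr⟩ := hsec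
  have := split_iso (indec_shift hKS har.indec₃ 1) har.indec₁.1 ψ' r hr
  exact ⟨asIso ψ'⟩

lemma ar_off (hKS : IsKrullSchmidt C) (hCY : IsTwoCalabiYau C K) {T : Set C}
    (hT : IsClusterTilting C T)
    (har : IsARTriangle C f g h) : X ∉ shiftSet C T ↔ Z ∉ T := by
  obtain ⟨e⟩ := ar_shift K hKS hCY har
  rw [not_iff_not]
  constructor
  · rintro ⟨t, ht, ⟨e'⟩⟩
    exact T_iso hT ((shiftFunctor C (1 : ℤ)).preimageIso (e'.symm.trans e)) ht
  · intro hZ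
    exact ⟨Z, hZ, ⟨e⟩⟩

lemma ar_factors {T : Set C} (hT : IsClusterTilting C T)
    (har : IsARTriangle C f g h) (hZ : Z ∉ T) : FactorsThruShift C T h := by
  apply factors_of_kill hT
  intro t ht u
  apply ar_kill har
  rintro ⟨s, hs⟩
  exact hZ (T_retract hT s u hs ht)

lemma ar_pair (homFin : ∀ X Y : C, FiniteDimensional K (X ⟶ Y)) {T : Set C}
    (hT : IsClusterTilting C T) (hd : Triangle.mk f g h ∈ distTriang C)
    (hf : FactorsThruShift C T h) (W : C) :
    bform K homFin hT (clsZero C W) (clsZero C X + clsZero C Z - clsZero C Y) =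
      Module.finrank K (LinearMap.range (Linear.rightComp K W h)) := by
  simp only [map_add, map_sub, bform_cls]
  exact eps_cov K homFin hT hd hf W

lemma ar_pair' (homFin : ∀ X Y : C, FiniteDimensional K (X ⟶ Y)) {T : Set C}
    (hT : IsClusterTilting C T) (hd : Triangle.mk f g h ∈ distTriang C)
    (hf : FactorsThruShift C T h) (hCY : IsTwoCalabiYau C K) (W : C) :
    bform K homFin hT (clsZero C X + clsZero C Z - clsZero C Y) (clsZero C (W⟦(1 : ℤ)⟧)) =
      Module.finrank K (LinearMap.range (Linear.rightComp K W h)) := by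
  rw [← bform_symm K homFin hCY hT _ W]
  · exact ar_pair K homFin hT hd hf W
  · rw [ker_gProj]
    exact AddSubgroup.subset_closure ⟨_, hd, hf, rfl⟩

lemma ar_pair_zero (har : IsARTriangle C f g h) {W : C} (hW : Indec W)
    (hWZ : ¬ Nonempty (W ≅ Z)) :
    Module.finrank K (LinearMap.range (Linear.rightComp K W h)) = 0 := by
  have : LinearMap.range (Linear.rightComp K W h) = ⊥ := by
    rw [LinearMap.range_eq_bot]
    ext u
    change u ≫ h = 0
    apply ar_kill har
    rintro ⟨s, hs⟩
    apply hWZ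
    have := split_iso hW har.indec₃.1 s u hs
    exact ⟨(asIso s).symm⟩
  rw [this, finrank_bot]

lemma ar_pair_pos (homFin : ∀ X Y : C, FiniteDimensional K (X ⟶ Y))
    (har : IsARTriangle C f g h) :
    0 < Module.finrank K (LinearMap.range (Linear.rightComp K Z h)) := by
  have := homFin Z (X⟦(1 : ℤ)⟧)
  rw [Module.finrank_pos_iff, Submodule.nontrivial_iff_ne_bot, Ne, LinearMap.range_eq_bot]
  intro h0
  apply ar_ne har
  have := LinearMap.congr_fun h0 (𝟙 Z)
  simpa using this

end

end AR

section Dvd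

set_option linter.unusedSectionVars false

variable {C : Type u} [Category.{v} C] [Preadditive C] [HasZeroObject C] [HasShift C ℤ]
  [∀ n : ℤ, (shiftFunctor C n).Additive] [Pretriangulated C] [HasFiniteBiproducts C]
variable (K : Type w) [Field K] [Linear K C]

lemma tower_end (Z A : C) : IsScalarTower K (End Z)ᵐᵒᵖ (Z ⟶ A) := by
  refine ⟨fun c a φ => ?_⟩
  change (c • (show Z ⟶ Z from a.unop)) ≫ φ = c • ((show Z ⟶ Z from a.unop) ≫ φ)
  rw [Linear.smul_comp]

lemma local_mop {R : Type*} [Ring R] (h : IsLocalRing R) : IsLocalRing Rᵐᵒᵖ := by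
  refine IsLocalRing.of_isUnit_or_isUnit_of_isUnit_add (fun a b hab => ?_)
  have h1 : IsUnit (a.unop + b.unop) := hab.unop
  rcases IsLocalRing.isUnit_or_isUnit_of_isUnit_add h1 with h | h
  · left
    exact h.op
  · right
    exact h.op

/-- Postcomposition as a map of modules over the endomorphism ring of the source. -/
def postR (Z : C) {A B : C} (h : A ⟶ B) : (Z ⟶ A) →ₗ[(End Z)ᵐᵒᵖ] (Z ⟶ B) where
  toFun u := u ≫ h
  map_add' _ _ := Preadditive.add_comp _ _ _ _ _ _
  map_smul' _ _ := Category.assoc _ _ _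

lemma ar_dvd (hKS : IsKrullSchmidt C) (homFin : ∀ X Y : C, FiniteDimensional K (X ⟶ Y))
    {X Y Z : C} {f : X ⟶ Y} {g : Y ⟶ Z} {h : Z ⟶ X⟦(1 : ℤ)⟧} (har : IsARTriangle C f g h)
    {A B : C} (h' : A ⟶ B) :
    Module.finrank K (LinearMap.range (Linear.rightComp K Z h)) ∣
      Module.finrank K (LinearMap.range (Linear.rightComp K Z h')) := by
  have hloc := local_mop (indec_local hKS har.indec₃)
  have i1 := tower_end K Z B
  have i2 := tower_end K Z (X⟦(1 : ℤ)⟧)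
  have := homFin Z B
  have hs : IsSimpleModule (End Z)ᵐᵒᵖ (LinearMap.range (postR Z h)) := by
    rw [isSimpleModule_iff_toSpanSingleton_surjective]
    constructor
    · refine ⟨⟨⟨h, 𝟙 Z, Category.id_comp _⟩, 0, fun h0 => ar_ne har (congrArg Subtype.val h0)⟩⟩
    · rintro ⟨_, u, rfl⟩ hu ⟨_, w, rfl⟩
      have hsp : ∃ s : Z ⟶ Z, s ≫ u = 𝟙 Z := by
        by_contra hc
        apply hu
        apply Subtype.ext
        exact ar_kill har u hc
      obtain ⟨s, hs⟩ := hsp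
      refine ⟨MulOpposite.op (w ≫ s), ?_⟩
      apply Subtype.ext
      change (w ≫ s) ≫ u ≫ h = w ≫ h
      rw [Category.assoc, ← Category.assoc s, hs, Category.id_comp]
  have hfd : FiniteDimensional K (LinearMap.range (postR Z h')) :=
    inferInstanceAs (FiniteDimensional K ((LinearMap.range (postR Z h')).restrictScalars K))
  have e1 : LinearMap.range (Linear.rightComp K Z h) =
      (LinearMap.range (postR Z h)).restrictScalars K := rfl
  have e2 : LinearMap.range (Linear.rightComp K Z h') =
      (LinearMap.range (postR Z h')).restrictScalars K := rfl
  rw [e1, e2]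
  exact dvd_finrank_of_simple (R := (End Z)ᵐᵒᵖ) (K := K) (S := LinearMap.range (postR Z h))
    (M := LinearMap.range (postR Z h'))

lemma ker_dvd (hKS : IsKrullSchmidt C) (homFin : ∀ X Y : C, FiniteDimensional K (X ⟶ Y))
    {T : Set C} (hT : IsClusterTilting C T)
    {X Y Z : C} {f : X ⟶ Y} {g : Y ⟶ Z} {h : Z ⟶ X⟦(1 : ℤ)⟧} (har : IsARTriangle C f g h)
    {x : K0Zero C} (hx : x ∈ (gProj C T).ker) :
    (Module.finrank K (LinearMap.range (Linear.rightComp K Z h)) : ℤ) ∣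
      bform K homFin hT (clsZero C Z) x := by
  rw [ker_gProj] at hx
  induction hx using AddSubgroup.closure_induction with
  | mem x hx =>
    obtain ⟨⟨X', Y', Z', f', g', h'⟩, hd, hf, rfl⟩ := hx
    have := ar_pair K homFin hT hd hf Z
    dsimp only at this ⊢
    erw [this]
    exact_mod_cast ar_dvd K hKS homFin har h'
  | zero => simp
  | add x y _ _ hx hy =>
    rw [map_add]
    exact dvd_add hx hy
  | neg x _ hx =>
    rw [map_neg]
    exact (dvd_neg).2 hx

end Dvd

section Backward

set_option linter.unusedSectionVars false

variable {C : Type u} [Category.{v} C] [Preadditive C] [HasZeroObject C] [HasShift C ℤ]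
  [∀ n : ℤ, (shiftFunctor C n).Additive] [Pretriangulated C] [HasFiniteBiproducts C]

lemma exists_reps (h : FinitelyManyIndec C) :
    ∃ (I : Type u) (_ : Fintype I) (Z : I → C), (∀ i, Indec (Z i)) ∧
      (∀ i j, Nonempty (Z i ≅ Z j) → i = j) ∧ ∀ W, Indec W → ∃ i, Nonempty (W ≅ Z i) := by
  obtain ⟨n, ind, hind⟩ := h
  let I := {q : Quotient (isIsomorphicSetoid C) // Indec q.out}
  have hinj : ∀ i j : I, Nonempty (i.1.out ≅ j.1.out) → i = j := by
    intro i j hij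
    apply Subtype.ext
    rw [← Quotient.out_eq i.1, ← Quotient.out_eq j.1]
    exact Quotient.sound hij
  choose φ hφ using fun i : I => hind i.1.out i.2
  have hfin : Finite I := by
    apply Finite.of_injective φ
    intro i j hij
    apply hinj
    obtain ⟨e⟩ := hφ i
    obtain ⟨e'⟩ := hφ j
    rw [← hij] at e'
    exact ⟨e.trans e'.symm⟩
  refine ⟨I, Fintype.ofFinite I, fun i => i.1.out, fun i => i.2, hinj, ?_⟩
  intro W hW
  have : IsIsomorphic (Quotient.mk (isIsomorphicSetoid C) W).out W :=
    Quotient.exact (s := isIsomorphicSetoid C) (Quotient.out_eq (Quotient.mk _ W))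
  obtain ⟨e⟩ := this
  exact ⟨⟨Quotient.mk _ W, indec_iso e.symm hW⟩, ⟨e.symm⟩⟩

lemma exists_coeffs (hKS : IsKrullSchmidt C) {I : Type*} [Fintype I] (Z : I → C)
    (hZ : ∀ W, Indec W → ∃ i, Nonempty (W ≅ Z i)) (y : K0Zero C) :
    ∃ c : I → ℤ, y = ∑ i, c i • clsZero C (Z i) := by
  let F : (I → ℤ) →+ K0Zero C :=
    { toFun := fun c => ∑ i, c i • clsZero C (Z i)
      map_zero' := by simp
      map_add' := by
        intro a b
        simp [add_smul, Finset.sum_add_distrib] }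
  have : y ∈ F.range := by
    apply cls_mem hKS
    intro W hW
    obtain ⟨i, ⟨e⟩⟩ := hZ W hW
    classical
    refine ⟨Pi.single i 1, ?_⟩
    change ∑ j, (Pi.single i (1 : ℤ) : I → ℤ) j • clsZero C (Z j) = _
    rw [Finset.sum_eq_single i]
    · simp [cls_iso e]
    · intro j _ hj
      simp [hj]
    · simp
  obtain ⟨c, hc⟩ := this
  exact ⟨c, hc.symm⟩

variable (K : Type w) [Field K] [Linear K C]

lemma bform_T_left (homFin : ∀ X Y : C, FiniteDimensional K (X ⟶ Y)) {T : Set C}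
    (hT : IsClusterTilting C T) {W : C} (hW : W ∈ T) : bform K homFin hT (clsZero C W) = 0 := by
  apply k0_hom_ext
  intro A
  rw [bform_cls]
  have : killE K T W (A⟦(1 : ℤ)⟧) = ⊥ := by
    rw [Submodule.eq_bot_iff]
    intro β hβ
    have := hβ W hW (𝟙 W)
    simpa using this
  unfold eps
  rw [this, finrank_bot]
  simp

lemma bform_T_right (homFin : ∀ X Y : C, FiniteDimensional K (X ⟶ Y)) {T : Set C}
    (hT : IsClusterTilting C T) {W : C} (hW : W ∈ T) (V : C) :
    bform K homFin hT (clsZero C V) (clsZero C W) = Module.finrank K (V ⟶ W⟦(1 : ℤ)⟧) := by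
  rw [bform_cls]
  have : killE K T V (W⟦(1 : ℤ)⟧) = ⊤ := by
    rw [Submodule.eq_top_iff']
    intro β t ht u
    exact (hT.char_left W).1 hW t ht _
  unfold eps
  rw [this, finrank_top]

section

variable {Y Z : C} {f : Z⟦(1 : ℤ)⟧ ⟶ Y} {g : Y ⟶ Z} {h : Z ⟶ Z⟦(1 : ℤ)⟧⟦(1 : ℤ)⟧}

lemma leftComp_inj {T : Set C} (hT : IsClusterTilting C T) (har : IsARTriangle C f g h)
    (hZ : Z ∈ T) {W : C} (hW : W ∈ T) :
    Function.Injective (Linear.leftComp K (W⟦(1 : ℤ)⟧) f) := by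
  rw [injective_iff_map_eq_zero]
  intro p hp
  obtain ⟨q, rfl⟩ := ex_yo2 har.distinguished p hp
  rw [(hT.char_left W).1 hW Z hZ q, comp_zero]

lemma T_pair_zero (hKS : IsKrullSchmidt C) (homFin : ∀ X Y : C, FiniteDimensional K (X ⟶ Y))
    {T : Set C} (hT : IsClusterTilting C T) (har : IsARTriangle C f g h)
    (hZ : Z ∈ T) {W : C} (hW : W ∈ T) (hWi : Indec W) (hWZ : ¬ Nonempty (Z ≅ W)) :
    bform K homFin hT (clsZero C (Z⟦(1 : ℤ)⟧) + clsZero C Z - clsZero C Y) (clsZero C W) = 0 := by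
  have hbij : Function.Bijective (Linear.leftComp K (W⟦(1 : ℤ)⟧) f) := by
    refine ⟨leftComp_inj K hT har hZ hW, ?_⟩
    intro u
    apply har.left_almost_split
    rintro ⟨r, hr⟩
    apply hWZ
    have := split_iso (indec_shift hKS hWi 1) har.indec₁.1 u r hr
    exact ⟨(shiftFunctor C (1 : ℤ)).preimageIso (asIso u)⟩
  have hfr := (LinearEquiv.ofBijective _ hbij).finrank_eq
  simp only [map_add, map_sub, AddMonoidHom.add_apply, AddMonoidHom.sub_apply,
    bform_T_left K homFin hT hZ, bform_T_right K homFin hT hW, hfr]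
  simp

lemma T_pair_ne (homFin : ∀ X Y : C, FiniteDimensional K (X ⟶ Y))
    {T : Set C} (hT : IsClusterTilting C T) (har : IsARTriangle C f g h) (hZ : Z ∈ T) :
    bform K homFin hT (clsZero C (Z⟦(1 : ℤ)⟧) + clsZero C Z - clsZero C Y) (clsZero C Z) ≠ 0 := by
  have hinj := leftComp_inj K hT har hZ hZ
  have := homFin (Z⟦(1 : ℤ)⟧) (Z⟦(1 : ℤ)⟧)
  have := homFin Y (Z⟦(1 : ℤ)⟧)
  simp only [map_add, map_sub, AddMonoidHom.add_apply, AddMonoidHom.sub_apply,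
    bform_T_left K homFin hT hZ, bform_T_right K homFin hT hZ]
  intro h0
  have hfr : Module.finrank K (Y ⟶ Z⟦(1 : ℤ)⟧) =
      Module.finrank K (Z⟦(1 : ℤ)⟧ ⟶ Z⟦(1 : ℤ)⟧) := by
    have h1 : (Module.finrank K (Z⟦(1 : ℤ)⟧ ⟶ Z⟦(1 : ℤ)⟧) : ℤ) + 0
      - (Module.finrank K (Y ⟶ Z⟦(1 : ℤ)⟧) : ℤ) = 0 := h0
    omega
  have hs := (LinearMap.injective_iff_surjective_of_finrank_eq_finrank hfr).1 hinj
  obtain ⟨r, hr⟩ := hs (𝟙 _)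
  exact har.not_section ⟨r, hr⟩

end

lemma l_le_ker (hKS : IsKrullSchmidt C) (hCY : IsTwoCalabiYau C K)
    {T : Set C} (hT : IsClusterTilting C T) :
    AddSubgroup.closure (arRelTriOff C T) ≤ (gProj C T).ker := by
  rw [ker_gProj]
  apply AddSubgroup.closure_mono
  rintro x ⟨X, Y, Z, f, g, h, har, hX, rfl⟩
  exact ⟨_, har.distinguished, ar_factors hT har ((ar_off K hKS hCY hT har).1 hX), rfl⟩

lemma backward (hKS : IsKrullSchmidt C) (homFin : ∀ X Y : C, FiniteDimensional K (X ⟶ Y))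
    (hCY : IsTwoCalabiYau C K) {T : Set C} (hT : IsClusterTilting C T)
    (hfin : FinitelyManyIndec C) :
    (gProj C T).ker ≤ AddSubgroup.closure (arRelTriOff C T) := by
  classical
  obtain ⟨I, _, Z, hZ, hinj, hrep⟩ := exists_reps hfin
  choose Y f g h har using fun i => ar_exists K hKS hCY (hZ i)
  let B := bform K homFin hT
  let d : I → ℤ := fun i => Module.finrank K (LinearMap.range (Linear.rightComp K (Z i) (h i)))
  have hd : ∀ i, d i ≠ 0 := fun i => by
    have := ar_pair_pos K homFin (har i)
    exact Int.natCast_ne_zero.2 this.ne'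
  let l : I → K0Zero C := fun i =>
    clsZero C ((Z i)⟦(1 : ℤ)⟧) + clsZero C (Z i) - clsZero C (Y i)
  have hl : ∀ i, Z i ∉ T → l i ∈ AddSubgroup.closure (arRelTriOff C T) := fun i hi =>
    AddSubgroup.subset_closure ⟨_, _, _, _, _, _, har i, (ar_off K hKS hCY hT (har i)).2 hi, rfl⟩
  have hpair : ∀ i j, Z i ∉ T → B (clsZero C (Z j)) (l i) = if j = i then d i else 0 := by
    intro i j hi
    have h1 := ar_pair K homFin hT (har i).distinguished (ar_factors hT (har i) hi) (Z j)
    refine h1.trans ?_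
    split_ifs with hij
    · subst hij
      rfl
    · rw [ar_pair_zero K (har i) (hZ j) (fun hn => hij (hinj _ _ hn))]
      rfl
  intro x hx
  choose q hq using fun i => ker_dvd K hKS homFin hT (har i) hx
  let c : I → ℤ := fun i => if Z i ∈ T then 0 else q i
  let s := ∑ i, c i • l i
  have hs : s ∈ AddSubgroup.closure (arRelTriOff C T) := by
    apply AddSubgroup.sum_mem
    intro i _
    by_cases hi : Z i ∈ T
    · simp only [c, if_pos hi, zero_smul]
      exact AddSubgroup.zero_mem _
    · exact AddSubgroup.zsmul_mem _ (hl i hi) _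
  suffices hxs : x - s = 0 by
    rw [sub_eq_zero] at hxs
    rw [hxs]
    exact hs
  have hy : x - s ∈ (gProj C T).ker :=
    AddSubgroup.sub_mem _ hx (l_le_ker K hKS hCY hT hs)
  have hBj : ∀ j, B (clsZero C (Z j)) (x - s) = 0 := by
    intro j
    by_cases hj : Z j ∈ T
    · simp only [B, bform_T_left K homFin hT hj, AddMonoidHom.zero_apply]
    · have h1 : B (clsZero C (Z j)) s = d j * q j := by
        simp only [s, map_sum, map_zsmul]
        rw [Finset.sum_eq_single j]
        · rw [hpair j j hj]
          simp [c, hj, mul_comm]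
        · intro i _ hij
          by_cases hi : Z i ∈ T
          · simp [c, hi]
          · rw [hpair i j hi, if_neg (Ne.symm hij), smul_zero]
        · simp
      rw [map_sub, h1]
      exact sub_eq_zero.2 (hq j)
  generalize x - s = y at hy hBj
  have hBl : B.flip y = 0 := by
    apply k0_hom_ext_indec hKS
    intro W hW
    obtain ⟨i, ⟨e⟩⟩ := hrep W hW
    rw [cls_iso e]
    exact hBj i
  have hBr : B y = 0 := by
    apply k0_hom_ext
    intro V
    have e : V ≅ (V⟦(-1 : ℤ)⟧)⟦(1 : ℤ)⟧ := ((shiftFunctorCompIsoId C (-1 : ℤ) 1 (by norm_num)).app V).symm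
    rw [cls_iso e]
    have h1 := bform_symm K homFin hCY hT hy (V⟦(-1 : ℤ)⟧)
    refine h1.symm.trans ?_
    exact DFunLike.congr_fun hBl (clsZero C (V⟦(-1 : ℤ)⟧))
  obtain ⟨a, rfl⟩ := exists_coeffs hKS Z hrep y
  have ha1 : ∀ j, Z j ∉ T → a j = 0 := by
    intro j hj
    have h1 : B (∑ i, a i • clsZero C (Z i)) (l j) = 0 := by rw [hBr]; rfl
    rw [map_sum, AddMonoidHom.finsetSum_apply, Finset.sum_eq_single j] at h1
    · rw [map_zsmul, AddMonoidHom.zsmul_apply, hpair j j hj, if_pos rfl] at h1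
      simpa [hd j] using h1
    · intro i _ hij
      rw [map_zsmul, AddMonoidHom.zsmul_apply, hpair j i hj, if_neg hij, smul_zero]
    · simp
  have ha2 : ∀ j, Z j ∈ T → a j = 0 := by
    intro j hj
    have h1 : B (l j) (∑ i, a i • clsZero C (Z i)) = 0 := DFunLike.congr_fun hBl (l j)
    rw [map_sum, Finset.sum_eq_single j] at h1
    · rw [map_zsmul] at h1
      have := T_pair_ne K homFin hT (har j) hj
      rcases smul_eq_zero.1 h1 with h2 | h2
      · exact h2
      · exact absurd h2 this
    · intro i _ hij
      rw [map_zsmul]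
      by_cases hi : Z i ∈ T
      · have := T_pair_zero K hKS homFin hT (har j) hj hi (hZ i)
          (fun hn => hij (hinj _ _ hn).symm)
        exact (congrArg (a i • ·) this).trans (smul_zero _)
      · rw [ha1 i hi, zero_smul]
    · simp
  apply Finset.sum_eq_zero
  intro i _
  by_cases hi : Z i ∈ T
  · rw [ha2 i hi, zero_smul]
  · rw [ha1 i hi, zero_smul]

end Backward

section Forward

set_option linter.unusedSectionVars false

variable {C : Type u} [Category.{v} C] [Preadditive C] [HasZeroObject C] [HasShift C ℤ]
  [∀ n : ℤ, (shiftFunctor C n).Additive] [Pretriangulated C] [HasFiniteBiproducts C]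

lemma T0_mem (T₀ : C) : T₀ ∈ addSet C T₀ := by
  obtain ⟨B, hB, -⟩ := split_summand (biproduct.ι (fun _ : Fin 1 => T₀) 0)
    (biproduct.π (fun _ : Fin 1 => T₀) 0) (by simp)
  exact ⟨1, B, hB⟩

lemma addSet_retract {T₀ W : C} (hW : W ∈ addSet C T₀) :
    ∃ (n : ℕ) (s : W ⟶ ⨁ fun _ : Fin n => T₀) (r : (⨁ fun _ : Fin n => T₀) ⟶ W),
      s ≫ r = 𝟙 W := by
  obtain ⟨n, Y, ⟨e⟩⟩ := hW
  exact ⟨n, biprod.inl ≫ e.inv, e.hom ≫ biprod.fst, by simp⟩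

lemma addSet_indec (hKS : IsKrullSchmidt C) (T₀ : C) :
    ∃ L : List C, ∀ W, Indec W → W ∈ addSet C T₀ → ∃ V ∈ L, Nonempty (W ≅ V) := by
  obtain ⟨m, f, hf, ⟨e⟩⟩ := hKS T₀
  refine ⟨List.ofFn f, ?_⟩
  intro W hW hWT
  obtain ⟨n, s, r, hsr⟩ := addSet_retract hWT
  have hloc := indec_local hKS hW
  let a : Fin n × Fin m → (End W) := fun p =>
    (s ≫ biproduct.π _ p.1 ≫ e.hom ≫ biproduct.π f p.2) ≫
      (biproduct.ι f p.2 ≫ e.inv ≫ biproduct.ι (fun _ : Fin n => T₀) p.1 ≫ r)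
  have hsum : ∑ p, a p = 1 := by
    change ∑ p, (show W ⟶ W from a p) = 𝟙 W
    rw [Fintype.sum_prod_type]
    have h1 : 𝟙 W = s ≫ (∑ k, biproduct.π (fun _ : Fin n => T₀) k ≫
        (e.hom ≫ (∑ i, biproduct.π f i ≫ biproduct.ι f i) ≫ e.inv) ≫
          biproduct.ι (fun _ : Fin n => T₀) k) ≫ r := by
      rw [biproduct.total]
      simp only [Category.id_comp, Iso.hom_inv_id]
      rw [biproduct.total, Category.id_comp, hsr]
    rw [h1]
    simp only [Preadditive.comp_sum, Preadditive.sum_comp, Category.assoc, a]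
  have hu : IsUnit (∑ p, a p) := by
    rw [hsum]
    exact isUnit_one
  obtain ⟨⟨k, i⟩, -, hki⟩ := IsLocalRing.exists_of_isUnit_sum hu
  refine ⟨f i, by simp, ?_⟩
  obtain ⟨⟨_, c, h1, h2⟩, rfl⟩ := hki
  change (show W ⟶ W from a (k, i)) ≫ (show W ⟶ W from c) = 𝟙 W at h2
  simp only [a] at h2
  rw [Category.assoc] at h2
  have := split_iso (local_indec (hf i)) hW.1 _ _ h2
  exact ⟨asIso (s ≫ biproduct.π _ k ≫ e.hom ≫ biproduct.π f i)⟩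

variable (K : Type w) [Field K] [Linear K C]

lemma finite_support (hKS : IsKrullSchmidt C) (homFin : ∀ X Y : C, FiniteDimensional K (X ⟶ Y))
    (hCY : IsTwoCalabiYau C K) {T : Set C} (hT : IsClusterTilting C T) {x : K0Zero C}
    (hx : x ∈ AddSubgroup.closure (arRelTriOff C T)) :
    ∃ L : List C, ∀ W, Indec W → bform K homFin hT (clsZero C W) x ≠ 0 →
      ∃ V ∈ L, Nonempty (W ≅ V) := by
  induction hx using AddSubgroup.closure_induction with
  | mem x hx =>
    obtain ⟨X, Y, Z, f, g, h, har, hX, rfl⟩ := hx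
    refine ⟨[Z], ?_⟩
    intro W hW hne
    refine ⟨Z, by simp, ?_⟩
    by_contra hc
    apply hne
    rw [ar_pair K homFin hT har.distinguished
      (ar_factors hT har ((ar_off K hKS hCY hT har).1 hX)) W, ar_pair_zero K har hW hc]
    rfl
  | zero => exact ⟨[], fun W _ h => absurd (map_zero _) h⟩
  | add x y _ _ hx hy =>
    obtain ⟨L, hL⟩ := hx
    obtain ⟨M, hM⟩ := hy
    refine ⟨L ++ M, ?_⟩
    intro W hW hne
    by_cases h1 : bform K homFin hT (clsZero C W) x = 0
    · rw [map_add, h1, zero_add] at hne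
      obtain ⟨V, hV, hi⟩ := hM W hW hne
      exact ⟨V, List.mem_append_right _ hV, hi⟩
    · obtain ⟨V, hV, hi⟩ := hL W hW h1
      exact ⟨V, List.mem_append_left _ hV, hi⟩
  | neg x _ hx =>
    obtain ⟨L, hL⟩ := hx
    refine ⟨L, fun W hW hne => hL W hW ?_⟩
    rw [map_neg] at hne
    exact neg_ne_zero.1 hne

lemma exists_map_T0 {T₀ : C} (hT : IsClusterTilting C (addSet C T₀)) {W : C}
    (hW : W ∉ addSet C T₀) : ∃ φ : W ⟶ T₀⟦(1 : ℤ)⟧, φ ≠ 0 := by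
  by_contra hc
  push Not at hc
  apply hW
  rw [hT.char_right]
  intro t ht φ
  obtain ⟨n, s, r, hsr⟩ := addSet_retract ht
  have h1 : φ ≫ (s ≫ (∑ k, biproduct.π (fun _ : Fin n => T₀) k ≫
      biproduct.ι (fun _ : Fin n => T₀) k) ≫ r)⟦(1 : ℤ)⟧' = φ := by
    rw [biproduct.total, Category.id_comp, hsr, CategoryTheory.Functor.map_id, Category.comp_id]
  rw [← h1, Preadditive.sum_comp, Preadditive.comp_sum, Functor.map_sum, Preadditive.comp_sum]
  apply Finset.sum_eq_zero
  intro k _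
  rw [Category.assoc, ← Category.assoc s, Functor.map_comp, ← Category.assoc,
    hc (φ ≫ (s ≫ biproduct.π (fun _ : Fin n => T₀) k)⟦(1 : ℤ)⟧'), zero_comp]

lemma forward (hKS : IsKrullSchmidt C) (homFin : ∀ X Y : C, FiniteDimensional K (X ⟶ Y))
    (hCY : IsTwoCalabiYau C K) {T₀ : C} (hT : IsClusterTilting C (addSet C T₀))
    (hker : (gProj C (addSet C T₀)).ker ≤ AddSubgroup.closure (arRelTriOff C (addSet C T₀))) :
    FinitelyManyIndec C := by
  have hd : Triangle.mk (0 : T₀ ⟶ 0) (0 : 0 ⟶ T₀⟦(1 : ℤ)⟧) (-((𝟙 T₀)⟦(1 : ℤ)⟧')) ∈ distTriang C :=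
    rot_of_distTriang _ (contractible_distinguished T₀)
  have hf : FactorsThruShift C (addSet C T₀) (-((𝟙 T₀)⟦(1 : ℤ)⟧')) :=
    ⟨T₀, T0_mem T₀, 𝟙 _, _, Category.id_comp _⟩
  have hx : clsZero C T₀ + clsZero C (T₀⟦(1 : ℤ)⟧) - clsZero C 0 ∈
      (gProj C (addSet C T₀)).ker := by
    rw [ker_gProj]
    exact AddSubgroup.subset_closure ⟨_, hd, hf, rfl⟩
  obtain ⟨L, hL⟩ := finite_support K hKS homFin hCY hT (hker hx)
  obtain ⟨M, hM⟩ := addSet_indec hKS T₀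
  refine ⟨(L ++ M).length, (L ++ M).get, ?_⟩
  intro W hW
  have : ∃ V ∈ L ++ M, Nonempty (W ≅ V) := by
    by_cases hWT : W ∈ addSet C T₀
    · obtain ⟨V, hV, hi⟩ := hM W hW hWT
      exact ⟨V, List.mem_append_right _ hV, hi⟩
    · obtain ⟨V, hV, hi⟩ := hL W hW (by
        rw [ar_pair K homFin hT hd hf W]
        obtain ⟨φ, hφ⟩ := exists_map_T0 hT hWT
        have := homFin W (T₀⟦(1 : ℤ)⟧)
        rw [Int.natCast_ne_zero, Ne, Submodule.finrank_eq_zero, LinearMap.range_eq_bot]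
        intro h0
        apply hφ
        have := LinearMap.congr_fun h0 φ
        simpa using this)
      exact ⟨V, List.mem_append_left _ hV, hi⟩
  obtain ⟨V, hV, hi⟩ := this
  obtain ⟨i, rfl⟩ := List.get_of_mem hV
  exact ⟨i, hi⟩

end Forward

end Helpers

theorem stmt10 (C : Type u) [Category.{v} C] [Preadditive C] [HasZeroObject C] [HasShift C ℤ]
    [∀ n : ℤ, (shiftFunctor C n).Additive] [Pretriangulated C] [HasFiniteBiproducts C]
    (hKS : IsKrullSchmidt C) (K : Type w) [Field K] [Linear K C]
    (homFin : ∀ X Y : C, FiniteDimensional K (X ⟶ Y))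
    (hCY : IsTwoCalabiYau C K) (T₀ : C) (hT : IsClusterTilting C (addSet C T₀)) :
    (gProj C (addSet C T₀)).ker = AddSubgroup.closure (arRelTriOff C (addSet C T₀)) ↔
      FinitelyManyIndec C := by
  exact ⟨fun h => forward K hKS homFin hCY hT h.le, fun h =>
    le_antisymm (backward K hKS homFin hCY hT h) (l_le_ker K hKS hCY hT)⟩
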